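/- arXiv:1606.08937 — 2 statements merged into one kernel-verified Lean document; each statement's English description precedes it below -/
import Mathlib

section
/- Let p > 0 and 0 < γ < 1. Then S_{1,p}(γ) = (1/γ) ∑_{k≥1} ∫_0^∞ x e^{−kx − p/x} sin(γx) dx. -/
open Real MeasureTheory

/-- Bessel function of the first kind of integer order, via Bessel's integral. -/
noncomputable def besselJ (m : ℤ) (x : ℝ) : ℝ :=
  (1 / Real.pi) * ∫ θ in (0:ℝ)..Real.pi, Real.cos ((m : ℝ) * θ - x * Real.sin θ)

/-- Modified Bessel function of the second kind (real argument). -/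
noncomputable def besselK (ν x : ℝ) : ℝ :=
  ∫ t in Set.Ioi (0:ℝ), Real.exp (-x * Real.cosh t) * Real.cosh (ν * t)

/-- Modified Bessel function of the second kind (complex argument). -/
noncomputable def besselKC (ν : ℝ) (z : ℂ) : ℂ :=
  ∫ t in Set.Ioi (0:ℝ), Complex.exp (-z * (Real.cosh t : ℂ)) * (Real.cosh (ν * t) : ℂ)

/-- The p-extended Riemann zeta function. -/
noncomputable def zetaP (p α : ℝ) : ℝ :=
  (1 / Real.Gamma α) *
    ∫ t in Set.Ioi (0:ℝ), t ^ (α - 1) * Real.exp (-p / t) / (Real.exp t - 1)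

/-- The p-extended Mathieu series. -/
noncomputable def mathieuS (μ p r : ℝ) : ℝ :=
  2 * ∑' n : ℕ, (-1 : ℝ) ^ n *
      (Real.Gamma (μ + n + 1) / (n.factorial * Real.Gamma (μ + 1))) *
      zetaP p (2 * μ + 2 * n + 1) * r ^ (2 * n)

/-- The Bose–Einstein weight satisfies `t / (exp t - 1) ≤ (1 + t) * exp (-t)`. -/
theorem div_exp_sub_one_le {t : ℝ} (ht : 0 < t) :
    t / (Real.exp t - 1) ≤ (1 + t) * Real.exp (-t) := by
  have h1 : t + 1 ≤ Real.exp t := Real.add_one_le_exp t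
  have h2 : 0 < Real.exp t - 1 := by linarith
  rw [div_le_iff₀ h2]
  have h3 : (1 + t) * Real.exp (-t) * (Real.exp t - 1) = (1 + t) * (1 - Real.exp (-t)) := by
    have : Real.exp (-t) * Real.exp t = 1 := by rw [← Real.exp_add]; simp
    linear_combination (1 + t) * this
  rw [h3]
  have h4 : (1 + t) * Real.exp (-t) ≤ 1 := by
    rw [Real.exp_neg, ← div_eq_mul_inv, div_le_one (Real.exp_pos t)]
    linarith
  linarith

theorem integrableOn_one_add_mul_exp_neg {c : ℝ} (hc : 0 < c) :
    IntegrableOn (fun t : ℝ => (1 + t) * Real.exp (-c * t)) (Set.Ioi 0) := by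
  have h1 : IntegrableOn (fun t : ℝ => Real.exp (-c * t)) (Set.Ioi 0) :=
    exp_neg_integrableOn_Ioi 0 hc
  have h2 := integrableOn_rpow_mul_exp_neg_mul_rpow (p := 1) (s := 1) (b := c)
    (by norm_num) (by norm_num) hc
  simp only [Real.rpow_one] at h2
  refine (h1.add h2).congr_fun (fun t _ => ?_) measurableSet_Ioi
  simp only [Pi.add_apply]
  ring

theorem hasSum_exp_neg_succ_mul {x : ℝ} (hx : 0 < x) :
    HasSum (fun k : ℕ => Real.exp (-((k : ℝ) + 1) * x)) (1 / (Real.exp x - 1)) := by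
  have h1 : Real.exp (-x) < 1 := by simpa using hx
  have h := (hasSum_geometric_of_lt_one (Real.exp_pos (-x)).le h1).mul_left (Real.exp (-x))
  have h2 : 1 < Real.exp x := by simpa using hx
  have e1 : (fun k : ℕ => Real.exp (-((k : ℝ) + 1) * x)) =
      fun k : ℕ => Real.exp (-x) * Real.exp (-x) ^ k := by
    funext k
    rw [← Real.exp_nat_mul, ← Real.exp_add]
    congr 1
    ring
  have e2 : 1 / (Real.exp x - 1) = Real.exp (-x) * (1 - Real.exp (-x))⁻¹ := by
    rw [Real.exp_neg]
    have : Real.exp x - 1 ≠ 0 := by linarith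
    field_simp
  rw [e1, e2]
  exact h

theorem exp_neg_div_le_one {p t : ℝ} (hp : 0 ≤ p) (ht : 0 < t) : Real.exp (-p / t) ≤ 1 := by
  rw [Real.exp_le_one_iff]
  exact div_nonpos_of_nonpos_of_nonneg (by linarith) ht.le

/-- Termwise integration of the geometric expansion of `1 / (exp x - 1)`. -/
theorem hasSum_integral_mul_exp_mul_sin {p : ℝ} (hp : 0 ≤ p) (γ : ℝ) :
    HasSum (fun k : ℕ => ∫ x in Set.Ioi (0:ℝ),
        x * Real.exp (-((k : ℝ) + 1) * x - p / x) * Real.sin (γ * x))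
      (∫ x in Set.Ioi (0:ℝ),
        x * Real.sin (γ * x) * (Real.exp (-p / x) / (Real.exp x - 1))) := by
  have hb : ∀ x : ℝ, 0 < x → HasSum (fun k : ℕ => x * Real.exp (-((k : ℝ) + 1) * x))
      (x / (Real.exp x - 1)) := fun x hx => by
    simpa [div_eq_mul_inv] using (hasSum_exp_neg_succ_mul hx).mul_left x
  refine hasSum_integral_of_dominated_convergence
    (fun (k : ℕ) x => x * Real.exp (-((k : ℝ) + 1) * x)) ?_ ?_ ?_ ?_ ?_
  · intro k
    exact Measurable.aestronglyMeasurable (by fun_prop)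
  · intro k
    refine (ae_restrict_iff' measurableSet_Ioi).2 (.of_forall fun x (hx : 0 < x) => ?_)
    rw [norm_mul, norm_mul, Real.norm_of_nonneg hx.le, Real.norm_of_nonneg (Real.exp_pos _).le]
    have h1 : Real.exp (-((k : ℝ) + 1) * x - p / x) ≤ Real.exp (-((k : ℝ) + 1) * x) := by
      gcongr
      have : 0 ≤ p / x := by positivity
      linarith
    have h2 : ‖Real.sin (γ * x)‖ ≤ 1 := Real.abs_sin_le_one _
    calc _ ≤ x * Real.exp (-((k : ℝ) + 1) * x) * 1 := by gcongr
      _ = _ := mul_one _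
  · exact (ae_restrict_iff' measurableSet_Ioi).2 (.of_forall fun x hx => (hb x hx).summable)
  · have hi : IntegrableOn (fun x : ℝ => x / (Real.exp x - 1)) (Set.Ioi 0) := by
      refine Integrable.mono' (integrableOn_one_add_mul_exp_neg one_pos)
        (Measurable.aestronglyMeasurable (by fun_prop)) ?_
      refine (ae_restrict_iff' measurableSet_Ioi).2 (.of_forall fun x (hx : 0 < x) => ?_)
      have h2 : 1 < Real.exp x := by simpa using hx
      rw [Real.norm_of_nonneg (div_nonneg hx.le (by linarith))]
      simpa using div_exp_sub_one_le hx
    exact IntegrableOn.congr_fun hi (fun x hx => (hb x hx).tsum_eq.symm) measurableSet_Ioi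
  · refine (ae_restrict_iff' measurableSet_Ioi).2 (.of_forall fun x (hx : 0 < x) => ?_)
    have e1 : (fun k : ℕ =>
          x * Real.exp (-((k : ℝ) + 1) * x - p / x) * Real.sin (γ * x)) =
        fun k : ℕ =>
          x * Real.sin (γ * x) * Real.exp (-p / x) * Real.exp (-((k : ℝ) + 1) * x) := by
      funext k
      rw [sub_eq_add_neg, Real.exp_add, neg_div]
      ring
    have h :=
      (hasSum_exp_neg_succ_mul hx).mul_left (x * Real.sin (γ * x) * Real.exp (-p / x))
    rw [mul_assoc _ (Real.exp (-p / x)) (1 / _), mul_one_div, ← e1] at h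
    exact h

/-- Termwise integration of the power series of the sine against the Bose–Einstein weight. -/
theorem hasSum_integral_sin_series {p γ : ℝ} (hp : 0 ≤ p) (hγ0 : 0 < γ) (hγ1 : γ < 1) :
    HasSum (fun n : ℕ => ∫ x in Set.Ioi (0:ℝ),
        x * ((-1) ^ n * (γ * x) ^ (2 * n + 1) / ((2 * n + 1).factorial : ℝ)) *
          (Real.exp (-p / x) / (Real.exp x - 1)))
      (∫ x in Set.Ioi (0:ℝ),
        x * Real.sin (γ * x) * (Real.exp (-p / x) / (Real.exp x - 1))) := by
  have hb : ∀ x : ℝ, HasSum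
      (fun n : ℕ => x / (Real.exp x - 1) * ((γ * x) ^ (2 * n + 1) / ((2 * n + 1).factorial : ℝ)))
      (x / (Real.exp x - 1) * Real.sinh (γ * x)) := fun x =>
    (Real.hasSum_sinh (γ * x)).mul_left _
  refine hasSum_integral_of_dominated_convergence
    (fun (n : ℕ) x =>
      x / (Real.exp x - 1) * ((γ * x) ^ (2 * n + 1) / ((2 * n + 1).factorial : ℝ))) ?_ ?_ ?_ ?_ ?_
  · intro n
    exact Measurable.aestronglyMeasurable (by fun_prop)
  · intro n
    refine (ae_restrict_iff' measurableSet_Ioi).2 (.of_forall fun x (hx : 0 < x) => ?_)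
    have h2 : 0 < Real.exp x - 1 := by simpa using hx
    have h3 := exp_neg_div_le_one hp hx
    simp only [norm_mul, norm_div, norm_pow, norm_neg, norm_one, one_pow, one_mul]
    rw [Real.norm_of_nonneg hx.le, Real.norm_of_nonneg hγ0.le, Real.norm_of_nonneg h2.le,
      Real.norm_of_nonneg (Real.exp_pos _).le, Real.norm_of_nonneg (Nat.cast_nonneg _)]
    calc x * ((γ * x) ^ (2 * n + 1) / ((2 * n + 1).factorial : ℝ)) *
          (Real.exp (-p / x) / (Real.exp x - 1))
        ≤ x * ((γ * x) ^ (2 * n + 1) / ((2 * n + 1).factorial : ℝ)) *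
          (1 / (Real.exp x - 1)) := by gcongr
      _ = _ := by ring
  · exact .of_forall fun x => (hb x).summable
  · simp only [fun x => (hb x).tsum_eq]
    refine Integrable.mono' (integrableOn_one_add_mul_exp_neg (sub_pos.2 hγ1))
      (Measurable.aestronglyMeasurable (by fun_prop)) ?_
    refine (ae_restrict_iff' measurableSet_Ioi).2 (.of_forall fun x (hx : 0 < x) => ?_)
    have h2 : 0 < Real.exp x - 1 := by simpa using hx
    have h3 : 0 ≤ Real.sinh (γ * x) := Real.sinh_nonneg_iff.2 (by positivity)
    have h4 : Real.sinh (γ * x) ≤ Real.exp (γ * x) := by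
      rw [Real.sinh_eq]
      have := Real.exp_pos (γ * x)
      have := Real.exp_pos (-(γ * x))
      linarith
    rw [Real.norm_of_nonneg (by positivity)]
    calc _ ≤ (1 + x) * Real.exp (-x) * Real.exp (γ * x) := by
          gcongr
          exact div_exp_sub_one_le hx
      _ = _ := by
          rw [mul_assoc, ← Real.exp_add]
          congr 2
          ring
  · refine .of_forall fun x => ?_
    exact ((Real.hasSum_sin (γ * x)).mul_left x).mul_right _

/-- Each term of the `p`-extended Mathieu series with `μ = 1` is a term of the sine expansion. -/
theorem mathieuS_one_term (p : ℝ) {γ : ℝ} (hγ0 : γ ≠ 0) (n : ℕ) :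
    2 * ((-1 : ℝ) ^ n * (Real.Gamma (1 + n + 1) / (n.factorial * Real.Gamma (1 + 1))) *
      zetaP p (2 * 1 + 2 * n + 1) * γ ^ (2 * n)) =
    (1 / γ) * ∫ x in Set.Ioi (0:ℝ),
        x * ((-1) ^ n * (γ * x) ^ (2 * n + 1) / ((2 * n + 1).factorial : ℝ)) *
          (Real.exp (-p / x) / (Real.exp x - 1)) := by
  have e1 : Real.Gamma (1 + n + 1) = (n + 1) * n.factorial := by
    have := Real.Gamma_nat_eq_factorial (n + 1)
    rw [Nat.factorial_succ] at this
    push_cast at this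
    rw [← this]
    congr 1
    ring
  have e2 : Real.Gamma (1 + 1) = 1 := by
    rw [one_add_one_eq_two, Real.Gamma_two]
  have e3 : Real.Gamma (2 * 1 + 2 * n + 1) = (2 * n + 2) * (2 * n + 1).factorial := by
    have := Real.Gamma_nat_eq_factorial (2 * n + 1 + 1)
    rw [Nat.factorial_succ] at this
    push_cast at this
    rw [show (2 * 1 + 2 * n + 1 : ℝ) = 2 * n + 1 + 1 + 1 by ring, this]
    ring
  have e4 : ∫ x in Set.Ioi (0:ℝ),
        x * ((-1) ^ n * (γ * x) ^ (2 * n + 1) / ((2 * n + 1).factorial : ℝ)) *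
          (Real.exp (-p / x) / (Real.exp x - 1)) =
      ((-1) ^ n * γ ^ (2 * n + 1) / ((2 * n + 1).factorial : ℝ)) * ∫ t in Set.Ioi (0:ℝ),
        t ^ ((2 * 1 + 2 * n + 1 : ℝ) - 1) * Real.exp (-p / t) / (Real.exp t - 1) := by
    rw [← integral_const_mul]
    refine setIntegral_congr_fun measurableSet_Ioi fun t _ => ?_
    have : (2 * 1 + 2 * n + 1 : ℝ) - 1 = ((2 * n + 2 : ℕ) : ℝ) := by
      push_cast
      ring
    simp only [this, Real.rpow_natCast]
    ring
  rw [e4, zetaP, e1, e2, e3]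
  have f1 : (n.factorial : ℝ) ≠ 0 := by positivity
  have f2 : ((2 * n + 1).factorial : ℝ) ≠ 0 := by positivity
  have f3 : (n + 1 : ℝ) ≠ 0 := by positivity
  have f4 : (2 * n + 2 : ℝ) ≠ 0 := by positivity
  field_simp
  ring

theorem stmt7 (p γ : ℝ) (hp : 0 < p) (hγ0 : 0 < γ) (hγ1 : γ < 1) :
    mathieuS 1 p γ =
      (1 / γ) * ∑' k : ℕ,
        ∫ x in Set.Ioi (0:ℝ), x * Real.exp (-((k : ℝ) + 1) * x - p / x) * Real.sin (γ * x) := by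
  rw [mathieuS, (hasSum_integral_mul_exp_mul_sin hp.le γ).tsum_eq, ← tsum_mul_left]
  simp only [mathieuS_one_term p hγ0.ne']
  exact ((hasSum_integral_sin_series hp.le hγ0 hγ1).mul_left (1 / γ)).tsum_eq
end

section
/- Let ν ∈ ℝ and p, q, γ > 0. Then ∫_0^∞ x^ν e^{−qx − p/x} cos(γx) dx = p^{(ν+1)/2} ( K_{ν+1}(2√(p(q + iγ))) / (q + iγ)^{(ν+1)/2} + K_{ν+1}(2√(p(q − iγ))) / (q − iγ)^{(ν+1)/2} ), where complex powers and square roots are principal and the right-hand side is a real number (the two summands are complex conjugates). -/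
open Real MeasureTheory

open ProbabilityTheory in
/-- A Laplace-type integral against a nonnegative weight is holomorphic on the right half-plane. -/
theorem differentiableOn_integral_cexp_neg_mul {α : Type*} [MeasurableSpace α] {μ : Measure α}
    {w X : α → ℝ} (hw : AEMeasurable w μ) (hw0 : ∀ᵐ x ∂μ, 0 ≤ w x)
    (hint : ∀ s : ℝ, 0 < s → Integrable (fun x => w x * Real.exp (-s * X x)) μ) :
    DifferentiableOn ℂ (fun z : ℂ => ∫ x, (w x : ℂ) * Complex.exp (-z * X x) ∂μ)
      {z | 0 < z.re} := by
  set ρ : Measure α := μ.withDensity fun x => ENNReal.ofReal (w x)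
  have hρ : Set.Iio (0 : ℝ) ⊆ integrableExpSet X ρ := by
    intro t ht
    have h := hint (-t) (by simpa using ht)
    change Integrable (fun x => Real.exp (t * X x)) ρ
    rw [integrable_withDensity_iff_integrable_smul₀' hw.ennreal_ofReal (by simp)]
    refine h.congr ?_
    filter_upwards [hw0] with x hx
    simp [ENNReal.toReal_ofReal hx]
  have hmgf : (fun z : ℂ => ∫ x, (w x : ℂ) * Complex.exp (-z * X x) ∂μ) =
      fun z => complexMGF X ρ (-z) := by
    ext z
    rw [complexMGF, integral_withDensity_eq_integral_toReal_smul₀ hw.ennreal_ofReal (by simp)]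
    refine integral_congr_ae ?_
    filter_upwards [hw0] with x hx
    simp [ENNReal.toReal_ofReal hx]
  rw [hmgf]
  refine differentiableOn_complexMGF.comp (differentiableOn_neg _) fun z hz => ?_
  refine interior_maximal hρ isOpen_Iio ?_
  simpa using hz

theorem sq_div_four_le_cosh (t : ℝ) : t ^ 2 / 4 ≤ Real.cosh t := by
  have h := Real.quadratic_le_exp_of_nonneg (abs_nonneg t)
  rw [sq_abs] at h
  rw [← Real.cosh_abs, Real.cosh_eq]
  linarith [Real.exp_pos (-|t|), abs_nonneg t]

theorem integrable_exp_mul_sub_mul_cosh (ν : ℝ) {s : ℝ} (hs : 0 < s) :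
    Integrable fun t : ℝ => Real.exp (ν * t - s * Real.cosh t) := by
  have hg : Integrable fun t : ℝ => Real.exp (ν * t - s / 4 * t ^ 2) := by
    have h := (integrable_cexp_quadratic (b := ((s / 4 : ℝ) : ℂ))
      (by rw [Complex.ofReal_re]; positivity) ν 0).re
    refine h.congr (.of_forall fun t => ?_)
    change (Complex.exp _).re = _
    rw [show -((s / 4 : ℝ) : ℂ) * (t : ℂ) ^ 2 + (ν : ℂ) * t + 0 =
      ((ν * t - s / 4 * t ^ 2 : ℝ) : ℂ) by push_cast; ring, Complex.exp_ofReal_re]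
  refine hg.mono' (by fun_prop) (.of_forall fun t => ?_)
  rw [Real.norm_eq_abs, Real.abs_exp]
  refine Real.exp_le_exp.2 ?_
  nlinarith [sq_div_four_le_cosh t]

theorem integrable_cosh_mul_exp_neg_mul_cosh (ν : ℝ) {s : ℝ} (hs : 0 < s) :
    Integrable fun t : ℝ => Real.cosh (ν * t) * Real.exp (-s * Real.cosh t) := by
  refine (((integrable_exp_mul_sub_mul_cosh ν hs).add
    (integrable_exp_mul_sub_mul_cosh (-ν) hs)).div_const 2).congr (.of_forall fun t => ?_)
  simp only [Pi.add_apply, sub_eq_add_neg, Real.exp_add, Real.cosh_eq (ν * t), neg_mul]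
  ring

theorem differentiableOn_besselKC (ν : ℝ) : DifferentiableOn ℂ (besselKC ν) {z | 0 < z.re} := by
  refine (differentiableOn_integral_cexp_neg_mul (μ := volume.restrict (Set.Ioi 0))
    (w := fun t => Real.cosh (ν * t)) (X := Real.cosh) (by fun_prop)
    (.of_forall fun t => (Real.cosh_pos _).le)
    fun s hs => (integrable_cosh_mul_exp_neg_mul_cosh ν hs).integrableOn).congr fun z _ => ?_
  simp only [besselKC, mul_comm]

theorem two_mul_besselKC_ofReal (ν : ℝ) {s : ℝ} (hs : 0 < s) :
    2 * besselKC ν s = ((∫ t : ℝ, Real.exp (ν * t - s * Real.cosh t) : ℝ) : ℂ) := by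
  have hK : besselKC ν s =
      ((∫ t in Set.Ioi (0 : ℝ), Real.cosh (ν * t) * Real.exp (-s * Real.cosh t) : ℝ) : ℂ) := by
    rw [besselKC, ← integral_complex_ofReal]
    congr 1 with t
    push_cast
    ring
  have heven := integral_comp_abs (f := fun t => Real.cosh (ν * t) * Real.exp (-s * Real.cosh t))
  have habs (t : ℝ) : Real.cosh (ν * |t|) = Real.cosh (ν * t) := by
    rw [← Real.cosh_abs, abs_mul, abs_abs, ← abs_mul, Real.cosh_abs]
  simp only [habs, Real.cosh_abs] at heven
  have hneg : ∫ t : ℝ, Real.exp (-ν * t - s * Real.cosh t) =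
      ∫ t : ℝ, Real.exp (ν * t - s * Real.cosh t) := by
    rw [← integral_neg_eq_self]
    simp
  have hsum : ∫ t : ℝ, Real.cosh (ν * t) * Real.exp (-s * Real.cosh t) =
      ∫ t : ℝ, Real.exp (ν * t - s * Real.cosh t) := by
    calc _ = ∫ t : ℝ, (Real.exp (ν * t - s * Real.cosh t) +
          Real.exp (-ν * t - s * Real.cosh t)) / 2 := by
          congr 1 with t
          simp only [sub_eq_add_neg, Real.exp_add, Real.cosh_eq (ν * t), neg_mul]
          ring
      _ = _ := by
          rw [integral_div, integral_add (integrable_exp_mul_sub_mul_cosh ν hs)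
            (integrable_exp_mul_sub_mul_cosh (-ν) hs), hneg]
          ring
  rw [hK, ← hsum, heven]
  push_cast
  rfl

theorem Set.image_const_mul_exp_univ {c : ℝ} (hc : 0 < c) :
    (fun t => c * Real.exp t) '' Set.univ = Set.Ioi 0 := by
  rw [← Set.image_image (fun x => c * x), Set.image_univ, Real.range_exp,
    Set.image_mul_left_Ioi hc, mul_zero]

section Substitution

variable {ν p s : ℝ}

theorem mul_rpow_mul_exp_comp_const_mul_exp (hp : 0 < p) (hs : 0 < s) (t : ℝ) :
    (√(p / s) * Real.exp t) * ((√(p / s) * Real.exp t) ^ ν * Real.exp (-p / (√(p / s) * Real.exp t))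
      * Real.exp (-s * (√(p / s) * Real.exp t))) =
    √(p / s) ^ (ν + 1) * Real.exp ((ν + 1) * t - 2 * √(p * s) * Real.cosh t) := by
  have hc : 0 < √(p / s) := by positivity
  have hsc : s * √(p / s) = √(p * s) := by
    rw [eq_comm, Real.sqrt_eq_iff_mul_self_eq (by positivity) (by positivity), mul_mul_mul_comm,
      Real.mul_self_sqrt (by positivity)]
    field_simp
  have hrc : √(p * s) * √(p / s) = p := by
    rw [← hsc, mul_assoc, Real.mul_self_sqrt (by positivity)]
    field_simp
  generalize √(p / s) = c at *
  generalize √(p * s) = r at *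
  have hpow : c * Real.exp t * (c * Real.exp t) ^ ν = c ^ (ν + 1) * Real.exp ((ν + 1) * t) := by
    rw [mul_comm (c * Real.exp t), ← Real.rpow_add_one (by positivity),
      Real.mul_rpow hc.le (Real.exp_pos t).le, ← Real.exp_mul, mul_comm t]
  have hdiv : -p / (c * Real.exp t) = -(r * Real.exp (-t)) := by
    rw [← hrc, Real.exp_neg]
    field_simp
  have hmul : -s * (c * Real.exp t) = -(r * Real.exp t) := by
    rw [← hsc]
    ring
  rw [hdiv, hmul, ← mul_assoc, ← mul_assoc, hpow, mul_assoc, mul_assoc, ← Real.exp_add,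
    ← Real.exp_add, Real.cosh_eq]
  congr 2
  ring

theorem integrableOn_rpow_mul_exp_neg_div_mul_exp_neg_mul (hp : 0 < p) (hs : 0 < s) :
    IntegrableOn (fun x : ℝ => x ^ ν * Real.exp (-p / x) * Real.exp (-s * x)) (Set.Ioi 0) := by
  have hc : 0 < √(p / s) := by positivity
  rw [← Set.image_const_mul_exp_univ hc, integrableOn_image_iff_integrableOn_abs_deriv_smul
    MeasurableSet.univ
    (fun t _ => ((Real.hasDerivAt_exp t).const_mul _).hasDerivWithinAt)
    ((mul_right_injective₀ hc.ne').comp Real.exp_injective).injOn, integrableOn_univ]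
  refine ((integrable_exp_mul_sub_mul_cosh (ν + 1) (s := 2 * √(p * s)) (by positivity)).const_mul
    (√(p / s) ^ (ν + 1))).congr (.of_forall fun t => ?_)
  simp only [smul_eq_mul]
  rw [abs_of_pos (by positivity), mul_rpow_mul_exp_comp_const_mul_exp hp hs]

theorem integral_rpow_mul_exp_neg_div_mul_exp_neg_mul (hp : 0 < p) (hs : 0 < s) :
    ∫ x in Set.Ioi (0 : ℝ), x ^ ν * Real.exp (-p / x) * Real.exp (-s * x) =
      √(p / s) ^ (ν + 1) * ∫ t : ℝ, Real.exp ((ν + 1) * t - 2 * √(p * s) * Real.cosh t) := by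
  have hc : 0 < √(p / s) := by positivity
  rw [← Set.image_const_mul_exp_univ hc, integral_image_eq_integral_abs_deriv_smul
    MeasurableSet.univ
    (fun t _ => ((Real.hasDerivAt_exp t).const_mul _).hasDerivWithinAt)
    ((mul_right_injective₀ hc.ne').comp Real.exp_injective).injOn, setIntegral_univ,
    ← integral_const_mul]
  congr 1 with t
  rw [smul_eq_mul, abs_of_pos (by positivity), mul_rpow_mul_exp_comp_const_mul_exp hp hs]

end Substitution

theorem Complex.re_cpow_one_half_pos {z : ℂ} (hz : 0 < z.re) : 0 < (z ^ (1 / 2 : ℂ)).re := by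
  have hz0 : z ≠ 0 := by
    rintro rfl
    simp at hz
  have him : (Complex.log z * (1 / 2)).im = z.arg / 2 := by
    rw [show (1 / 2 : ℂ) = ((1 / 2 : ℝ) : ℂ) by norm_num, Complex.im_mul_ofReal, Complex.log_im]
    ring
  rw [Complex.cpow_def_of_ne_zero hz0, Complex.exp_re, him]
  refine mul_pos (Real.exp_pos _) (Real.cos_pos_of_mem_Ioo ⟨?_, ?_⟩)
  · linarith [Complex.neg_pi_lt_arg z]
  · have := abs_le.1 (Complex.abs_arg_lt_pi_div_two_iff.2 (.inl hz)).le
    linarith [Real.pi_pos]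

/-- The Laplace transform of `x ^ ν * exp (-p / x)` on the right half-plane. -/
theorem integral_rpow_mul_exp_neg_div_mul_cexp_neg_mul (ν : ℝ) {p : ℝ} (hp : 0 < p) {z : ℂ}
    (hz : 0 < z.re) :
    ∫ x in Set.Ioi (0 : ℝ), ((x ^ ν * Real.exp (-p / x) : ℝ) : ℂ) * Complex.exp (-z * x) =
      2 * ((p ^ ((ν + 1) / 2) : ℝ) : ℂ) * (besselKC (ν + 1) (2 * ((p : ℂ) * z) ^ (1 / 2 : ℂ)) /
        z ^ (((ν + 1) / 2 : ℝ) : ℂ)) := by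
  have hopen : IsOpen {z : ℂ | 0 < z.re} := isOpen_lt continuous_const Complex.continuous_re
  have hconn : IsPreconnected {z : ℂ | 0 < z.re} := (convex_halfSpace_re_gt 0).isPreconnected
  have hre {z : ℂ} (hz : 0 < z.re) : 0 < ((p : ℂ) * z).re := by
    rw [Complex.re_ofReal_mul]
    positivity
  refine AnalyticOnNhd.eqOn_of_preconnected_of_frequently_eq
    (f := fun z : ℂ => ∫ x in Set.Ioi (0 : ℝ),
      ((x ^ ν * Real.exp (-p / x) : ℝ) : ℂ) * Complex.exp (-z * x))
    (g := fun z : ℂ => 2 * ((p ^ ((ν + 1) / 2) : ℝ) : ℂ) *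
      (besselKC (ν + 1) (2 * ((p : ℂ) * z) ^ (1 / 2 : ℂ)) / z ^ (((ν + 1) / 2 : ℝ) : ℂ)))
    (z₀ := 1) (DifferentiableOn.analyticOnNhd ?_ hopen) (DifferentiableOn.analyticOnNhd ?_ hopen)
    hconn (by simp) ?_ hz
  · refine differentiableOn_integral_cexp_neg_mul (X := fun x : ℝ => x)
      (by fun_prop) ?_ fun s hs => integrableOn_rpow_mul_exp_neg_div_mul_exp_neg_mul hp hs
    filter_upwards [ae_restrict_mem measurableSet_Ioi] with x hx
    have hx : 0 < x := hx
    positivity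
  · have hK : DifferentiableOn ℂ
        (fun z : ℂ => besselKC (ν + 1) (2 * ((p : ℂ) * z) ^ (1 / 2 : ℂ))) {z | 0 < z.re} := by
      refine (differentiableOn_besselKC (ν + 1)).comp (fun z hz => ?_) fun z hz => ?_
      · exact (((differentiableAt_id.const_mul (p : ℂ)).cpow_const
          (.inl (hre (z := z) hz))).const_mul 2).differentiableWithinAt
      · have := Complex.re_cpow_one_half_pos (hre hz)
        simpa using this
    refine (hK.div (fun z hz => ?_) fun z hz => ?_).const_mul _
    · exact (differentiableAt_id.cpow_const (.inl hz)).differentiableWithinAt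
    · rw [Complex.cpow_ne_zero_iff]
      left
      rintro rfl
      simp at hz
  · have htend : Filter.Tendsto (fun x : ℝ => (x : ℂ)) (nhdsWithin 1 {1}ᶜ)
        (nhdsWithin 1 {1}ᶜ) := by
      refine tendsto_nhdsWithin_iff.2 ⟨?_, ?_⟩
      · simpa using (Complex.continuous_ofReal.tendsto 1).mono_left nhdsWithin_le_nhds
      · filter_upwards [self_mem_nhdsWithin] with x hx
        simpa using hx
    refine htend.frequently (Filter.Eventually.frequently ?_)
    filter_upwards [nhdsWithin_le_nhds (lt_mem_nhds one_pos)] with s hs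
    have hK := two_mul_besselKC_ofReal (ν + 1) (s := 2 * √(p * s)) (by positivity)
    have hsqrt : ((p : ℂ) * s) ^ (1 / 2 : ℂ) = (√(p * s) : ℝ) := by
      rw [Real.sqrt_eq_rpow, Complex.ofReal_cpow (by positivity)]
      push_cast
      rfl
    have hpow : √(p / s) ^ (ν + 1) = p ^ ((ν + 1) / 2) / s ^ ((ν + 1) / 2) := by
      rw [← Real.div_rpow hp.le hs.le, Real.sqrt_eq_rpow, ← Real.rpow_mul (by positivity)]
      ring_nf
    calc _ = ((∫ x in Set.Ioi (0 : ℝ), x ^ ν * Real.exp (-p / x) * Real.exp (-s * x) : ℝ) : ℂ) := by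
          rw [← integral_complex_ofReal]
          congr 1 with x
          push_cast
          rfl
      _ = _ := by
          rw [integral_rpow_mul_exp_neg_div_mul_exp_neg_mul hp hs, Complex.ofReal_mul, ← hK, hpow,
            hsqrt, ← Complex.ofReal_cpow hs.le]
          push_cast
          ring

theorem integrableOn_rpow_mul_exp_neg_div_mul_cexp_neg_mul (ν : ℝ) {p : ℝ} (hp : 0 < p) {z : ℂ}
    (hz : 0 < z.re) :
    IntegrableOn (fun x : ℝ => ((x ^ ν * Real.exp (-p / x) : ℝ) : ℂ) * Complex.exp (-z * x))
      (Set.Ioi 0) := by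
  refine (integrableOn_rpow_mul_exp_neg_div_mul_exp_neg_mul (ν := ν) hp hz).mono'
    (by fun_prop) ?_
  filter_upwards [ae_restrict_mem measurableSet_Ioi] with x hx
  have hx : 0 < x := hx
  rw [norm_mul, Complex.norm_exp, Complex.norm_real, Real.norm_of_nonneg (by positivity)]
  simp

theorem stmt12 (ν p q γ : ℝ) (hp : 0 < p) (hq : 0 < q) (hγ : 0 < γ) :
    ((∫ x in Set.Ioi (0:ℝ), x ^ ν * Real.exp (-q * x - p / x) * Real.cos (γ * x) : ℝ) : ℂ) =
      ((p ^ ((ν + 1) / 2) : ℝ) : ℂ) *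
        (besselKC (ν + 1) (2 * ((p : ℂ) * ((q : ℂ) + Complex.I * γ)) ^ (1/2 : ℂ)) /
            ((q : ℂ) + Complex.I * γ) ^ (((ν + 1) / 2 : ℝ) : ℂ) +
          besselKC (ν + 1) (2 * ((p : ℂ) * ((q : ℂ) - Complex.I * γ)) ^ (1/2 : ℂ)) /
            ((q : ℂ) - Complex.I * γ) ^ (((ν + 1) / 2 : ℝ) : ℂ)) := by
  have hz₁ : 0 < ((q : ℂ) + Complex.I * γ).re := by simpa using hq
  have hz₂ : 0 < ((q : ℂ) - Complex.I * γ).re := by simpa using hq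
  have h₁ := integral_rpow_mul_exp_neg_div_mul_cexp_neg_mul ν hp hz₁
  have h₂ := integral_rpow_mul_exp_neg_div_mul_cexp_neg_mul ν hp hz₂
  have hsum := integral_add (integrableOn_rpow_mul_exp_neg_div_mul_cexp_neg_mul ν hp hz₁)
    (integrableOn_rpow_mul_exp_neg_div_mul_cexp_neg_mul ν hp hz₂)
  rw [h₁, h₂] at hsum
  calc _ = (1 / 2 : ℂ) * ∫ x in Set.Ioi (0 : ℝ),
        (((x ^ ν * Real.exp (-p / x) : ℝ) : ℂ) * Complex.exp (-((q : ℂ) + Complex.I * γ) * x) +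
        ((x ^ ν * Real.exp (-p / x) : ℝ) : ℂ) * Complex.exp (-((q : ℂ) - Complex.I * γ) * x)) := by
        rw [← integral_complex_ofReal, ← integral_const_mul]
        congr 1 with x
        rw [show -q * x - p / x = -p / x + -q * x by ring, Real.exp_add,
          show -((q : ℂ) + Complex.I * γ) * x = -q * x + -(γ * x) * Complex.I by ring,
          show -((q : ℂ) - Complex.I * γ) * x = -q * x + (γ * x) * Complex.I by ring,
          Complex.exp_add, Complex.exp_add]
        push_cast
        rw [Complex.cos]
        ring
    _ = _ := by
        rw [hsum]
        ring
end
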